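/- arXiv:2212.05104 — 2 statements merged into one kernel-verified Lean document; each statement's English description precedes it below -/
import Mathlib

section
/- Let A, B be symmetric n×n real matrices with eigenvalues λ₁ ≤ ... ≤ λₙ and μ₁ ≤ ... ≤ μₙ respectively. If tr(AB) = Σᵢ λᵢμᵢ, then there exists an orthonormal basis u₁,...,uₙ of ℝⁿ with A = Σᵢ λᵢ uᵢuᵢᵀ and B = Σᵢ μᵢ uᵢuᵢᵀ. -/
open Matrix

/-- The trace of the product of two conjugated diagonal matrices. -/
lemma vn_trace_formula {n : ℕ} (U V : Matrix (Fin n) (Fin n) ℝ) (a b : Fin n → ℝ) :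
    ((U * diagonal a * Uᵀ) * (V * diagonal b * Vᵀ)).trace
      = ∑ i, ∑ j, a i * b j * ((Uᵀ * V) i j) ^ 2 := by
  have h : ((U * diagonal a * Uᵀ) * (V * diagonal b * Vᵀ)).trace
      = ((diagonal a * (Uᵀ * V)) * (diagonal b * (Uᵀ * V)ᵀ)).trace := by
    rw [Matrix.transpose_mul, Matrix.transpose_transpose]
    simp only [Matrix.mul_assoc]
    rw [Matrix.trace_mul_comm]
    simp only [Matrix.mul_assoc]
  rw [h, Matrix.trace]
  refine Finset.sum_congr rfl fun i _ => ?_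
  rw [Matrix.diag_apply, Matrix.mul_apply]
  refine Finset.sum_congr rfl fun j _ => ?_
  rw [Matrix.diagonal_mul, Matrix.diagonal_mul, Matrix.transpose_apply]
  ring

/-- The von Neumann trace inequality. -/
lemma vn_trace_le {n : ℕ} (U V : Matrix (Fin n) (Fin n) ℝ)
    (hU : U ∈ Matrix.orthogonalGroup (Fin n) ℝ) (hV : V ∈ Matrix.orthogonalGroup (Fin n) ℝ)
    (a b : Fin n → ℝ) (ha : Monotone a) (hb : Monotone b) :
    ((U * diagonal a * Uᵀ) * (V * diagonal b * Vᵀ)).trace ≤ ∑ i, a i * b i := by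
  rw [vn_trace_formula]
  have hW : Uᵀ * V ∈ Matrix.orthogonalGroup (Fin n) ℝ :=
    mul_mem (by simpa [Matrix.star_eq_conjTranspose] using Unitary.star_mem hU) hV
  generalize Uᵀ * V = W at hW
  have hmem : (Matrix.of fun i j => W i j ^ 2) ∈ doublyStochastic ℝ (Fin n) := by
    rw [mem_doublyStochastic_iff_sum]
    refine ⟨fun i j => sq_nonneg _, fun i => ?_, fun j => ?_⟩
    · have := congrFun (congrFun (Matrix.mem_orthogonalGroup_iff (Fin n) ℝ |>.1 hW) i) i
      simpa [Matrix.mul_apply, sq] using this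
    · have := congrFun (congrFun (Matrix.mem_orthogonalGroup_iff' (Fin n) ℝ |>.1 hW) j) j
      simpa [Matrix.mul_apply, sq] using this
  obtain ⟨w, hw0, hw1, hw⟩ := exists_eq_sum_perm_of_mem_doublyStochastic hmem
  have hent : ∀ i j, W i j ^ 2 = ∑ σ : Equiv.Perm (Fin n), w σ * if σ i = j then 1 else 0 := by
    intro i j
    have := congrFun (congrFun hw i) j
    rw [Matrix.sum_apply] at this
    simp only [Matrix.of_apply] at this
    rw [← this]
    refine Finset.sum_congr rfl fun σ _ => ?_
    simp [PEquiv.toMatrix_apply, eq_comm]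
  have mono : Monovary a b := ha.monovary hb
  calc ∑ i, ∑ j, a i * b j * W i j ^ 2
      = ∑ σ : Equiv.Perm (Fin n), w σ * ∑ i, a i * b (σ i) := by
        simp_rw [hent, Finset.mul_sum]
        rw [Finset.sum_congr rfl fun i _ => Finset.sum_comm, Finset.sum_comm]
        refine Finset.sum_congr rfl fun σ _ => Finset.sum_congr rfl fun i _ => ?_
        simp
        ring
    _ ≤ ∑ σ : Equiv.Perm (Fin n), w σ * ∑ i, a i * b i :=
        Finset.sum_le_sum fun σ _ =>
          mul_le_mul_of_nonneg_left mono.sum_mul_comp_perm_le_sum_mul (hw0 σ)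
    _ = ∑ i, a i * b i := by rw [← Finset.sum_mul, hw1, one_mul]

/-- Trace of a product of matrices diagonal in the same basis. -/
lemma vn_trace_same {n : ℕ} (U : Matrix (Fin n) (Fin n) ℝ)
    (hU : U ∈ Matrix.orthogonalGroup (Fin n) ℝ) (a b : Fin n → ℝ) :
    ((U * diagonal a * Uᵀ) * (U * diagonal b * Uᵀ)).trace = ∑ i, a i * b i := by
  have h : Uᵀ * U = 1 := Matrix.mem_orthogonalGroup_iff' (Fin n) ℝ |>.1 hU
  rw [vn_trace_formula, h]
  simp [Matrix.one_apply]

/-- Sorted spectral theorem. -/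
lemma vn_spectral {n : ℕ} (C : Matrix (Fin n) (Fin n) ℝ) (hC : Cᵀ = C) :
    ∃ U ∈ Matrix.orthogonalGroup (Fin n) ℝ, ∃ nu : Fin n → ℝ, Monotone nu ∧
      C = U * diagonal nu * Uᵀ := by
  have hH : C.IsHermitian := by
    rw [Matrix.IsHermitian, Matrix.conjTranspose_eq_transpose_of_trivial, hC]
  let σ := Tuple.sort hH.eigenvalues
  let V : Matrix (Fin n) (Fin n) ℝ := hH.eigenvectorUnitary
  have hV : V * Vᵀ = 1 :=
    Matrix.mem_orthogonalGroup_iff (Fin n) ℝ |>.1 hH.eigenvectorUnitary.2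
  have hs : C = V * diagonal hH.eigenvalues * Vᵀ := by
    have := hH.spectral_theorem
    rw [Unitary.conjStarAlgAut_apply] at this
    exact this
  refine ⟨V.submatrix id σ, ?_, hH.eigenvalues ∘ σ, Tuple.monotone_sort _, ?_⟩
  · refine (Matrix.mem_orthogonalGroup_iff (Fin n) ℝ).2 ?_
    change V.submatrix id σ * (V.submatrix id σ)ᵀ = 1
    rw [Matrix.transpose_submatrix, Matrix.submatrix_mul_equiv, hV]
    simp
  · have hd : diagonal (hH.eigenvalues ∘ σ) = (diagonal hH.eigenvalues).submatrix σ σ := by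
      simp
    rw [hd, Matrix.transpose_submatrix, Matrix.submatrix_mul_equiv, Matrix.submatrix_mul_equiv,
      ← hs]
    simp

lemma vn_sym {n : ℕ} (U : Matrix (Fin n) (Fin n) ℝ) (a : Fin n → ℝ) :
    (U * diagonal a * Uᵀ)ᵀ = U * diagonal a * Uᵀ := by
  simp [Matrix.transpose_mul, Matrix.mul_assoc]

/-- Two symmetric matrices at Frobenius distance zero are equal. -/
lemma vn_eq {n : ℕ} (X Y : Matrix (Fin n) (Fin n) ℝ) (hX : Xᵀ = X) (hY : Yᵀ = Y) (s : ℝ)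
    (h1 : (X * X).trace = s) (h2 : (Y * Y).trace = s) (h3 : (X * Y).trace = s) : X = Y := by
  have h : ((X - Y)ᴴ * (X - Y)).trace = 0 := by
    rw [Matrix.conjTranspose_eq_transpose_of_trivial, Matrix.transpose_sub, hX, hY,
      Matrix.sub_mul, Matrix.mul_sub, Matrix.mul_sub, Matrix.trace_sub, Matrix.trace_sub,
      Matrix.trace_sub, Matrix.trace_mul_comm Y X, h1, h2, h3]
    ring
  exact sub_eq_zero.1 (Matrix.trace_conjTranspose_mul_self_eq_zero_iff.1 h)

theorem symmetric_von_neumann_equality_case {n : ℕ}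
    (A B : Matrix (Fin n) (Fin n) ℝ) (lam mu : Fin n → ℝ)
    (hlam : Monotone lam) (hmu : Monotone mu)
    (hA : ∃ U ∈ Matrix.orthogonalGroup (Fin n) ℝ, A = U * Matrix.diagonal lam * Uᵀ)
    (hB : ∃ U ∈ Matrix.orthogonalGroup (Fin n) ℝ, B = U * Matrix.diagonal mu * Uᵀ)
    (heq : (A * B).trace = ∑ i, lam i * mu i) :
    ∃ U ∈ Matrix.orthogonalGroup (Fin n) ℝ,
      A = U * Matrix.diagonal lam * Uᵀ ∧ B = U * Matrix.diagonal mu * Uᵀ := by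
  obtain ⟨P, hP, hAP⟩ := hA
  obtain ⟨Q, hQ, hBQ⟩ := hB
  have sA : Aᵀ = A := by rw [hAP, vn_sym]
  have sB : Bᵀ = B := by rw [hBQ, vn_sym]
  obtain ⟨U, hU, nu, hnu, hC⟩ := vn_spectral (A + B) (by rw [Matrix.transpose_add, sA, sB])
  have tAA : (A * A).trace = ∑ i, lam i * lam i := by rw [hAP, vn_trace_same P hP]
  have tBB : (B * B).trace = ∑ i, mu i * mu i := by rw [hBQ, vn_trace_same Q hQ]
  have tBA : (B * A).trace = ∑ i, lam i * mu i := by rw [Matrix.trace_mul_comm, heq]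
  have tCC : ((A + B) * (A + B)).trace = ∑ i, nu i * nu i := by rw [hC, vn_trace_same U hU]
  have tCA : ((A + B) * A).trace ≤ ∑ i, nu i * lam i := by
    rw [hC, hAP]; exact vn_trace_le U P hU hP nu lam hnu hlam
  have tCB : ((A + B) * B).trace ≤ ∑ i, nu i * mu i := by
    rw [hC, hBQ]; exact vn_trace_le U Q hU hQ nu mu hnu hmu
  simp only [Matrix.mul_add, Matrix.add_mul, Matrix.trace_add] at tCC tCA tCB
  have hsq : ∑ i, (nu i - (lam i + mu i)) ^ 2 = ∑ i, nu i * nu i + ∑ i, lam i * lam i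
      + ∑ i, mu i * mu i + 2 * ∑ i, lam i * mu i - 2 * ∑ i, nu i * lam i
      - 2 * ∑ i, nu i * mu i := by
    simp only [Finset.mul_sum, ← Finset.sum_add_distrib, ← Finset.sum_sub_distrib]
    exact Finset.sum_congr rfl fun i _ => by ring
  have hz : ∑ i, (nu i - (lam i + mu i)) ^ 2 = 0 :=
    le_antisymm (by linarith) (Finset.sum_nonneg fun i _ => sq_nonneg _)
  have hnueq : nu = fun i => lam i + mu i := by
    funext i
    have := (Finset.sum_eq_zero_iff_of_nonneg (fun i _ => sq_nonneg _)).1 hz i (Finset.mem_univ i)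
    exact sub_eq_zero.1 (pow_eq_zero_iff two_ne_zero |>.1 this)
  have hsum : A + B = U * diagonal lam * Uᵀ + U * diagonal mu * Uᵀ := by
    rw [hC, hnueq, ← Matrix.diagonal_add, Matrix.mul_add, Matrix.add_mul]
  have h1 : ((U * diagonal lam * Uᵀ) * A).trace ≤ ∑ i, lam i * lam i := by
    rw [hAP]; exact vn_trace_le U P hU hP lam lam hlam hlam
  have h2 : ((U * diagonal mu * Uᵀ) * A).trace ≤ ∑ i, mu i * lam i := by
    rw [hAP]; exact vn_trace_le U P hU hP mu lam hmu hlam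
  have h3 : (A * A).trace + (B * A).trace
      = ((U * diagonal lam * Uᵀ) * A).trace + ((U * diagonal mu * Uᵀ) * A).trace := by
    rw [← Matrix.trace_add, ← Matrix.add_mul, hsum, Matrix.add_mul, Matrix.trace_add]
  have hcomm : ∑ i, mu i * lam i = ∑ i, lam i * mu i :=
    Finset.sum_congr rfl fun i _ => mul_comm _ _
  have hAU : U * diagonal lam * Uᵀ = A :=
    vn_eq _ _ (vn_sym _ _) sA _ (vn_trace_same U hU lam lam) tAA (by linarith)
  refine ⟨U, hU, hAU.symm, ?_⟩
  rw [hAU] at hsum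
  exact add_left_cancel hsum
end

section
/- Let K : L²([0,1]) → L²([0,1]) be the integral operator with kernel K(x,y) = √2·(1-x) if y ≤ x and K(x,y) = -√2·x if y > x. Then the operator norm of K equals √2/π. -/
open MeasureTheory

/-- The kernel from the analysis of the type `A_ℓ` Coxeter groups. -/
noncomputable def Kker (x y : ℝ) : ℝ :=
  if y ≤ x then Real.sqrt 2 * (1 - x) else -(Real.sqrt 2 * x)

lemma Kker_eq (x y : ℝ) : Kker x y = Real.sqrt 2 * ((Set.Iic x).indicator (fun _ => (1:ℝ)) y - x) := by
  unfold Kker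
  by_cases h : y ≤ x
  · simp [h]
  · simp [h]

lemma Kker_measurable (x : ℝ) : Measurable (Kker x) := by
  unfold Kker
  exact Measurable.ite measurableSet_Iic measurable_const measurable_const

lemma Kker_ne_zero {x : ℝ} (hx : x ∈ Set.Ioo (0:ℝ) 1) (y : ℝ) : Kker x y ≠ 0 := by
  have h2 : Real.sqrt 2 ≠ 0 := by positivity
  have h3 : (1 - x) ≠ 0 := by linarith [hx.2]
  have h4 : x ≠ 0 := hx.1.ne'
  unfold Kker
  split_ifs
  · exact mul_ne_zero h2 h3
  · exact neg_ne_zero.mpr (mul_ne_zero h2 h4)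

lemma Kker_integral {f : ℝ → ℝ} (hf : IntervalIntegrable f volume 0 1) {x : ℝ}
    (hx : x ∈ Set.Ioc (0:ℝ) 1) :
    ∫ y in Set.Ioc (0:ℝ) 1, Kker x y * f y =
      Real.sqrt 2 * ((∫ y in (0:ℝ)..x, f y) - x * ∫ y in (0:ℝ)..1, f y) := by
  have hfi : IntegrableOn f (Set.Ioc 0 1) := by
    rwa [intervalIntegrable_iff_integrableOn_Ioc_of_le zero_le_one] at hf
  have e : ∀ y, Kker x y * f y =
      Real.sqrt 2 * ((Set.Iic x).indicator f y - x * f y) := by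
    intro y
    rw [Kker_eq]
    by_cases h : y ∈ Set.Iic x
    · simp only [Set.indicator_of_mem h]; ring
    · simp only [Set.indicator_of_notMem h]; ring
  simp_rw [e]
  rw [integral_const_mul, integral_sub (hfi.indicator measurableSet_Iic) (hfi.const_mul x),
    integral_const_mul, setIntegral_indicator measurableSet_Iic,
    intervalIntegral.integral_of_le hx.1.le, intervalIntegral.integral_of_le zero_le_one]
  congr 4
  ext y
  have := hx.2
  simp only [Set.mem_inter_iff, Set.mem_Ioc, Set.mem_Iic]
  constructor
  · rintro ⟨⟨a, b⟩, c⟩; exact ⟨a, c⟩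
  · rintro ⟨a, b⟩; exact ⟨⟨a, b.trans this⟩, b⟩

lemma wirtinger_aux {g : ℝ → ℝ} (hg : IntervalIntegrable g volume 0 1)
    (hg2 : IntervalIntegrable (fun x => g x ^ 2) volume 0 1)
    (h0 : ∫ x in (0:ℝ)..1, g x = 0) {α : ℝ} (hα0 : 0 < α) (hα : α < Real.pi) :
    α ^ 2 * ∫ x in (0:ℝ)..1, (∫ y in (0:ℝ)..x, g y) ^ 2 ≤ ∫ x in (0:ℝ)..1, g x ^ 2 := by
  set G : ℝ → ℝ := fun x => ∫ y in (0:ℝ)..x, g y with hG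
  set φ : ℝ → ℝ := fun x => α * Real.tan (α * (x - 1/2)) with hφ
  have hcos : ∀ x ∈ Set.uIcc (0:ℝ) 1, Real.cos (α * (x - 1/2)) ≠ 0 := by
    intro x hx
    rw [Set.uIcc_of_le zero_le_one] at hx
    apply ne_of_gt
    apply Real.cos_pos_of_mem_Ioo
    constructor <;> nlinarith [hx.1, hx.2]
  have hd : ∀ x ∈ Set.uIcc (0:ℝ) 1, HasDerivAt φ (α ^ 2 + φ x ^ 2) x := by
    intro x hx
    have h1 : HasDerivAt (fun x : ℝ => α * (x - 1/2)) (α * 1) x :=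
      ((hasDerivAt_id x).sub_const _).const_mul α
    have h2 := ((Real.hasDerivAt_tan (hcos x hx)).comp x h1).const_mul α
    refine h2.congr_deriv ?_
    have := hcos x hx
    simp only [hφ, Real.tan_eq_sin_div_cos]
    have h3 := Real.cos_sq_add_sin_sq (α * (x - 1/2))
    generalize α * (x - 1/2) = t at *
    field_simp
    linarith
  have hφC : ContDiffOn ℝ 1 φ (Set.uIcc 0 1) := by
    intro x hx
    apply ContDiffAt.contDiffWithinAt
    refine contDiffAt_const.mul ?_
    have h1 : ContDiffAt ℝ 1 (fun x : ℝ => α * (x - 1/2)) x := by fun_prop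
    exact ContDiffAt.comp (g := Real.tan) x (Real.contDiffAt_tan.mpr (hcos x hx)) h1
  have hφac : AbsolutelyContinuousOnInterval φ 0 1 := hφC.absolutelyContinuousOnInterval
  have hGac : AbsolutelyContinuousOnInterval G 0 1 :=
    hg.absolutelyContinuousOnInterval_intervalIntegral (by simp)
  have hG2ac : AbsolutelyContinuousOnInterval (fun x => G x * G x) 0 1 := hGac.fun_mul hGac
  have key := hφac.integral_deriv_mul_eq_sub hG2ac
  have hG0 : G 0 = 0 := by simp [hG]
  have hG1 : G 1 = 0 := h0
  simp only [hG0, hG1, mul_zero, sub_zero] at key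
  have hint : IntervalIntegrable
      (fun x => deriv φ x * (G x * G x) + φ x * deriv (fun x => G x * G x) x) volume 0 1 :=
    (hφac.intervalIntegrable_deriv.mul_continuousOn hG2ac.continuousOn).add
      (hG2ac.intervalIntegrable_deriv.continuousOn_mul hφac.continuousOn)
  have hGint : IntervalIntegrable (fun x => G x ^ 2) volume 0 1 :=
    (hGac.continuousOn.pow 2).intervalIntegrable
  have hsum : ∫ x in (0:ℝ)..1, (g x ^ 2 +
      (deriv φ x * (G x * G x) + φ x * deriv (fun x => G x * G x) x)) = ∫ x in (0:ℝ)..1, g x ^ 2 := by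
    rw [intervalIntegral.integral_add hg2 hint, key, add_zero]
  rw [← hsum, ← intervalIntegral.integral_const_mul]
  apply intervalIntegral.integral_mono_ae_restrict zero_le_one (hGint.const_mul _) (hg2.add hint)
  filter_upwards [ae_restrict_of_ae hg.ae_hasDerivAt_integral,
    ae_restrict_mem measurableSet_Icc] with x hx hxm
  rw [← Set.uIcc_of_le (zero_le_one (α := ℝ))] at hxm
  have hGd : HasDerivAt G (g x) x := hx hxm 0 (by simp)
  have e1 := (hGd.fun_mul hGd).deriv
  have e2 := (hd x hxm).deriv
  simp only [e1, e2]
  nlinarith [sq_nonneg (g x + φ x * G x)]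

lemma wirtinger {g : ℝ → ℝ} (hg : IntervalIntegrable g volume 0 1)
    (hg2 : IntervalIntegrable (fun x => g x ^ 2) volume 0 1)
    (h0 : ∫ x in (0:ℝ)..1, g x = 0) :
    Real.pi ^ 2 * ∫ x in (0:ℝ)..1, (∫ y in (0:ℝ)..x, g y) ^ 2 ≤ ∫ x in (0:ℝ)..1, g x ^ 2 := by
  have hc : Filter.Tendsto (fun α : ℝ => α ^ 2 * ∫ x in (0:ℝ)..1, (∫ y in (0:ℝ)..x, g y) ^ 2)
      (nhdsWithin Real.pi (Set.Iio Real.pi))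
      (nhds (Real.pi ^ 2 * ∫ x in (0:ℝ)..1, (∫ y in (0:ℝ)..x, g y) ^ 2)) := by
    apply Filter.Tendsto.mono_left _ nhdsWithin_le_nhds
    exact Continuous.tendsto (by fun_prop) _
  refine le_of_tendsto hc ?_
  filter_upwards [Ioo_mem_nhdsLT Real.pi_pos] with α hα
  exact wirtinger_aux hg hg2 h0 hα.1 hα.2

lemma Kker_bound {f : ℝ → ℝ}
    (hf2 : Integrable (fun y => f y ^ 2) (volume.restrict (Set.Ioc (0 : ℝ) 1)))
    (h1 : (∫ y in Set.Ioc (0 : ℝ) 1, f y ^ 2) = 1) :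
    ∫ x in Set.Ioc (0 : ℝ) 1, (∫ y in Set.Ioc (0 : ℝ) 1, Kker x y * f y) ^ 2
      ≤ 2 / Real.pi ^ 2 := by
  by_cases hm : AEStronglyMeasurable f (volume.restrict (Set.Ioc (0 : ℝ) 1))
  · have hL : MemLp f 2 (volume.restrict (Set.Ioc (0 : ℝ) 1)) :=
      (memLp_two_iff_integrable_sq hm).mpr hf2
    have hfi : Integrable f (volume.restrict (Set.Ioc (0 : ℝ) 1)) := hL.integrable (by norm_num)
    have hf : IntervalIntegrable f volume 0 1 := by
      rw [intervalIntegrable_iff_integrableOn_Ioc_of_le zero_le_one]; exact hfi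
    have hf2' : IntervalIntegrable (fun y => f y ^ 2) volume 0 1 := by
      rw [intervalIntegrable_iff_integrableOn_Ioc_of_le zero_le_one]; exact hf2
    rw [← intervalIntegral.integral_of_le zero_le_one] at h1
    set c := ∫ y in (0:ℝ)..1, f y with hc
    have hg : IntervalIntegrable (fun y => f y - c) volume 0 1 := hf.sub (by simp)
    have hexp : ∀ y, (f y - c) ^ 2 = f y ^ 2 - (2 * c) * f y + c ^ 2 := fun y => by ring
    have hA : IntervalIntegrable (fun y => f y ^ 2 - (2 * c) * f y) volume 0 1 :=
      hf2'.sub (hf.const_mul (2 * c))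
    have hg2 : IntervalIntegrable (fun y => (f y - c) ^ 2) volume 0 1 := by
      simp_rw [hexp]
      exact hA.add (by simp)
    have hg0 : ∫ y in (0:ℝ)..1, (f y - c) = 0 := by
      rw [intervalIntegral.integral_sub hf (by simp)]; simp [hc]
    have hgn : ∫ y in (0:ℝ)..1, (f y - c) ^ 2 = 1 - c ^ 2 := by
      simp_rw [hexp]
      rw [intervalIntegral.integral_add hA (by simp),
        intervalIntegral.integral_sub hf2' (hf.const_mul (2 * c)),
        intervalIntegral.integral_const_mul, h1, ← hc]
      simp; ring
    have hw := wirtinger hg hg2 hg0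
    rw [hgn] at hw
    have e : ∫ x in Set.Ioc (0 : ℝ) 1, (∫ y in Set.Ioc (0 : ℝ) 1, Kker x y * f y) ^ 2
        = ∫ x in Set.Ioc (0 : ℝ) 1, 2 * (∫ y in (0:ℝ)..x, (f y - c)) ^ 2 := by
      apply setIntegral_congr_fun measurableSet_Ioc
      intro x hx
      have hfx : IntervalIntegrable f volume 0 x := hf.mono_set (by
        rw [Set.uIcc_of_le hx.1.le, Set.uIcc_of_le zero_le_one]
        exact Set.Icc_subset_Icc_right hx.2)
      simp only
      rw [Kker_integral hf hx, intervalIntegral.integral_sub hfx (by simp), mul_pow,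
        Real.sq_sqrt (by norm_num)]
      simp [hc]
    rw [e, integral_const_mul, ← intervalIntegral.integral_of_le zero_le_one,
      le_div_iff₀ (by positivity)]
    nlinarith [sq_nonneg c]
  · have hz : ∀ x ∈ Set.Ioo (0:ℝ) 1, ∫ y in Set.Ioc (0 : ℝ) 1, Kker x y * f y = 0 := by
      intro x hx
      apply integral_undef
      intro hi
      apply hm
      have := ((Kker_measurable x).inv.aestronglyMeasurable
        (μ := volume.restrict (Set.Ioc (0 : ℝ) 1))).mul hi.aestronglyMeasurable
      refine this.congr (Filter.Eventually.of_forall fun y => ?_)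
      have := Kker_ne_zero hx y
      simp [this]
    rw [integral_Ioc_eq_integral_Ioo, setIntegral_congr_fun (g := fun _ => (0:ℝ)) measurableSet_Ioo
      (fun x hx => by simp [hz x hx])]
    simp
    positivity

lemma integral_cos_sq_pi : ∫ x in (0:ℝ)..1, Real.cos (Real.pi * x) ^ 2 = 1 / 2 := by
  rw [intervalIntegral.integral_comp_mul_left (fun x => Real.cos x ^ 2) Real.pi_ne_zero]
  simp [integral_cos_sq]
  field_simp

lemma integral_sin_sq_pi : ∫ x in (0:ℝ)..1, Real.sin (Real.pi * x) ^ 2 = 1 / 2 := by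
  rw [intervalIntegral.integral_comp_mul_left (fun x => Real.sin x ^ 2) Real.pi_ne_zero]
  simp [integral_sin_sq]
  field_simp

theorem Kker_operator_norm :
    sSup {r | ∃ f : ℝ → ℝ,
        Integrable (fun y => f y ^ 2) (volume.restrict (Set.Ioc (0 : ℝ) 1)) ∧
        (∫ y in Set.Ioc (0 : ℝ) 1, f y ^ 2) = 1 ∧
        r = Real.sqrt (∫ x in Set.Ioc (0 : ℝ) 1,
          (∫ y in Set.Ioc (0 : ℝ) 1, Kker x y * f y) ^ 2)} =
      Real.sqrt 2 / Real.pi := by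
  have hs : Real.sqrt (2 / Real.pi ^ 2) = Real.sqrt 2 / Real.pi := by
    rw [Real.sqrt_div (by norm_num), Real.sqrt_sq Real.pi_pos.le]
  apply IsGreatest.csSup_eq
  constructor
  · have hcont : Continuous (fun y : ℝ => Real.sqrt 2 * Real.cos (Real.pi * y)) := by fun_prop
    refine ⟨fun y => Real.sqrt 2 * Real.cos (Real.pi * y), ?_, ?_, ?_⟩
    · exact ((hcont.pow 2).intervalIntegrable 0 1).1
    · rw [← intervalIntegral.integral_of_le zero_le_one]
      simp_rw [mul_pow]
      rw [intervalIntegral.integral_const_mul, integral_cos_sq_pi]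
      norm_num
    · rw [← hs]
      congr 1
      have hF : ∀ x : ℝ, ∫ y in (0:ℝ)..x, Real.sqrt 2 * Real.cos (Real.pi * y)
          = Real.sqrt 2 * (Real.sin (Real.pi * x) / Real.pi) := by
        intro x
        rw [intervalIntegral.integral_const_mul,
          intervalIntegral.integral_comp_mul_left (fun x => Real.cos x) Real.pi_ne_zero]
        simp
        field_simp
      have e : ∫ x in Set.Ioc (0 : ℝ) 1, (∫ y in Set.Ioc (0 : ℝ) 1,
            Kker x y * (Real.sqrt 2 * Real.cos (Real.pi * y))) ^ 2
          = ∫ x in Set.Ioc (0 : ℝ) 1, (4 / Real.pi ^ 2) * Real.sin (Real.pi * x) ^ 2 := by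
        apply setIntegral_congr_fun measurableSet_Ioc
        intro x hx
        simp only
        rw [Kker_integral (hcont.intervalIntegrable 0 1) hx, hF, hF]
        have h2 : Real.sqrt 2 ^ 2 = 2 := Real.sq_sqrt (by norm_num)
        simp only [mul_one, Real.sin_pi, zero_div, mul_zero, sub_zero]
        rw [← mul_assoc, ← pow_two, h2]
        ring
      rw [e, integral_const_mul, ← intervalIntegral.integral_of_le zero_le_one, integral_sin_sq_pi]
      ring
  · rintro r ⟨f, hf, h1, rfl⟩
    rw [← hs]
    exact Real.sqrt_le_sqrt (Kker_bound hf h1)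
end
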